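/- arXiv:1507.05155 — 3 statements merged into one kernel-verified Lean document; each statement's English description precedes it below -/
import Mathlib

section
/- Let A and Q be abelian groups and let f : A → Q be a function satisfying Bloch's relation. Then for every integer n ≥ 1 and all elements a, a_1, ..., a_n of A, one has Σ_{j=1}^n f(a_j + a) = f(a + Σ_{j=1}^n a_j) + Σ_{j=1}^n f(a_j) − f(Σ_{j=1}^n a_j) + (n−1)·(f(a) − f(0)) in Q. -/
/-- **Bloch's relation** for a function `f : A → Q` between abelian groups:
`f 0 - f a - f b - f c + f (a+b) + f (b+c) + f (c+a) - f (a+b+c) = 0` for all `a b c`. -/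
def BlochRelation {A Q : Type*} [AddCommGroup A] [AddCommGroup Q] (f : A → Q) : Prop :=
  ∀ a b c : A,
    f 0 - f a - f b - f c + f (a + b) + f (b + c) + f (c + a) - f (a + b + c) = 0

/-- Abstract form of Lemma 3.5: if `f` satisfies Bloch's relation, then for every `n ≥ 1`
and all `a, a_1, …, a_n`,
`∑_{j=1}^n f (a_j + a)
  = f (a + ∑_j a_j) + ∑_j f (a_j) - f (∑_j a_j) + (n-1) • (f a - f 0)`. -/
theorem sum_translate_eq_of_blochRelation {A Q : Type*} [AddCommGroup A] [AddCommGroup Q]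
    (f : A → Q) (hf : BlochRelation f) (n : ℕ) (hn : 1 ≤ n) (a : A) (as : Fin n → A) :
    ∑ j, f (as j + a) =
      f (a + ∑ j, as j) + ∑ j, f (as j) - f (∑ j, as j)
        + ((n : ℤ) - 1) • (f a - f 0) := by
  clear hn
  induction n with
  | zero => simp
  | succ k ih =>
    rw [Fin.sum_univ_castSucc, Fin.sum_univ_castSucc, Fin.sum_univ_castSucc,
      ih (fun j => as j.castSucc)]
    have h := hf a (∑ j : Fin k, as j.castSucc) (as (Fin.last k))
    rw [add_assoc a] at h
    have h2 : f (as (Fin.last k) + a) = f (as (Fin.last k) + a) - 0 := by simp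
    rw [h2, ← h]
    push_cast
    module
end

section
/- Let A and Q be abelian groups, let f : A → Q be a function satisfying Bloch's relation, and let n ≥ 1 be an integer. Let (c, a_1, ..., a_n) and (c', a'_1, ..., a'_n) be elements of A^{n+1} with c + Σ_{j=1}^n a_j = 0 and c' + Σ_{j=1}^n a'_j = 0. Assume: (i) f(c − n·c) + (n−1)·(f(c) − f(0)) = 0 and f(c' − n·c') + (n−1)·(f(c') − f(0)) = 0; (ii) f(n·c) + f(−n·c) = f(n·c') + f(−n·c'); (iii) f(n·c) + Σ_{j=1}^n f(n·a_j) = f(n·c') + Σ_{j=1}^n f(n·a'_j). Then Σ_{j=1}^n f(n·a_j + c) = Σ_{j=1}^n f(n·a'_j + c'). -/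
/-- Translation formula (Lemma 3.5) combined with hypothesis (i). -/
theorem bloch_sum_translate {A Q : Type*} [AddCommGroup A] [AddCommGroup Q]
    (f : A → Q) (hf : BlochRelation f) (n : ℕ) (c : A) (as : Fin n → A)
    (hc : c + ∑ j, as j = 0)
    (h1 : f (c - n • c) + ((n : ℤ) - 1) • (f c - f 0) = 0) :
    ∑ j, f (n • as j + c)
      = (f (n • c) + ∑ j, f (n • as j)) - (f (n • c) + f (-(n • c))) := by
  let D : A →+ Q := AddMonoidHom.mk' (fun x => f (x + c) - f x - (f c - f 0)) (by
    intro x y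
    have h := hf x y c
    rw [add_comm c x] at h
    rw [← sub_eq_zero, ← neg_eq_zero, ← h]
    abel)
  have hD : ∀ x, D x = f (x + c) - f x - (f c - f 0) := fun _ => rfl
  have hs : ∑ j, n • as j = -(n • c) := by
    rw [← Finset.smul_sum, ← smul_neg, eq_neg_of_add_eq_zero_right hc]
  have h := map_sum D (fun j => n • as j) Finset.univ
  rw [hs] at h
  simp only [hD, Finset.sum_sub_distrib, Finset.sum_const, Finset.card_univ,
    Fintype.card_fin] at h
  rw [neg_add_eq_sub] at h
  rw [sub_smul, one_smul, natCast_zsmul] at h1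
  rw [← smul_sub] at h
  generalize n • (f c - f 0) = u at h h1
  have h4 : f (c - n • c) = -(u - (f c - f 0)) := eq_neg_of_add_eq_zero_left h1
  rw [h4] at h
  rw [eq_comm, sub_sub, sub_eq_iff_eq_add] at h
  rw [h]
  abel

/-- Formal skeleton of Lemma 3.6: under Bloch's relation and the listed hypotheses (i)–(iii),
`∑_{j=1}^n f (n • a_j + c) = ∑_{j=1}^n f (n • a'_j + c')`. -/
theorem sum_eq_of_blochRelation {A Q : Type*} [AddCommGroup A] [AddCommGroup Q]
    (f : A → Q) (hf : BlochRelation f) (n : ℕ) (hn : 1 ≤ n)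
    (c c' : A) (as as' : Fin n → A)
    (hc : c + ∑ j, as j = 0) (hc' : c' + ∑ j, as' j = 0)
    (h1 : f (c - n • c) + ((n : ℤ) - 1) • (f c - f 0) = 0)
    (h1' : f (c' - n • c') + ((n : ℤ) - 1) • (f c' - f 0) = 0)
    (h2 : f (n • c) + f (-(n • c)) = f (n • c') + f (-(n • c')))
    (h3 : f (n • c) + ∑ j, f (n • as j) = f (n • c') + ∑ j, f (n • as' j)) :
    ∑ j, f (n • as j + c) = ∑ j, f (n • as' j + c') := by
  rw [bloch_sum_translate f hf n c as hc h1, bloch_sum_translate f hf n c' as' hc' h1', h2, h3]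
end

section
/- Let k be a commutative ring, V a k-module, ω : V × V → k a k-bilinear form, and n ≥ 1 an integer. Let u_0, u_1, ..., u_n and w_0, w_1, ..., w_n be elements of V such that Σ_{i=0}^n u_i = 0, Σ_{i=0}^n w_i = 0, and Σ_{i=0}^n ω(u_i, w_i) = 0. Then Σ_{i=1}^n ω(u_0 + n·u_i, w_0 + n·w_i) = −n·(n+1)·ω(u_0, w_0). In particular, when n·(n+1) is invertible in k, this sum vanishes if and only if ω(u_0, w_0) = 0. -/
/-- The linear-algebra identity underlying formula (3.4) in Lemma 3.4: given a bilinear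
form `ω` on a `k`-module `V` and vectors `u_0, …, u_n`, `w_0, …, w_n` with
`∑ u_i = 0`, `∑ w_i = 0` and `∑ ω (u_i) (w_i) = 0`, one has
`∑_{i=1}^n ω (u_0 + n • u_i) (w_0 + n • w_i) = -(n*(n+1)) • ω (u_0) (w_0)`;
in particular if `n*(n+1)` is invertible in `k`, this sum vanishes iff `ω (u_0) (w_0) = 0`. -/
theorem bilin_sum_translate_eq {k V : Type*} [CommRing k] [AddCommGroup V] [Module k V]
    (ω : V →ₗ[k] V →ₗ[k] k) (n : ℕ) (hn : 1 ≤ n)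
    (u w : Fin (n + 1) → V)
    (hu : ∑ i, u i = 0) (hw : ∑ i, w i = 0)
    (hω : ∑ i, ω (u i) (w i) = 0) :
    (∑ i : Fin n, ω (u 0 + n • u i.succ) (w 0 + n • w i.succ)
        = -((n : k) * ((n : k) + 1)) * ω (u 0) (w 0))
    ∧ (IsUnit ((n : k) * ((n : k) + 1)) →
        ((∑ i : Fin n, ω (u 0 + n • u i.succ) (w 0 + n • w i.succ)) = 0
          ↔ ω (u 0) (w 0) = 0)) := by
  have main : ∑ i : Fin n, ω (u 0 + n • u i.succ) (w 0 + n • w i.succ)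
        = -((n : k) * ((n : k) + 1)) * ω (u 0) (w 0) := by
    rw [Fin.sum_univ_succ] at hu hw hω
    have hu' : ∑ i : Fin n, ω (u i.succ) (w 0) = -ω (u 0) (w 0) := by
      have h := congrArg (fun v => ω v (w 0)) hu
      simp only [map_add, map_sum, LinearMap.add_apply, LinearMap.sum_apply, map_zero,
        LinearMap.zero_apply] at h
      linear_combination h
    have hw' : ∑ i : Fin n, ω (u 0) (w i.succ) = -ω (u 0) (w 0) := by
      have h := congrArg (fun v => ω (u 0) v) hw
      simp only [map_add, map_sum, map_zero] at h
      linear_combination h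
    have e : ∀ i : Fin n, ω (u 0 + n • u i.succ) (w 0 + n • w i.succ)
        = ω (u 0) (w 0) + (n : k) * ω (u 0) (w i.succ) + (n : k) * ω (u i.succ) (w 0)
          + (n : k) * (n : k) * ω (u i.succ) (w i.succ) := by
      intro i
      simp only [map_add, map_nsmul, LinearMap.add_apply, LinearMap.smul_apply, nsmul_eq_mul]
      ring
    simp only [e, Finset.sum_add_distrib, ← Finset.mul_sum, hu', hw', Finset.sum_const,
      Finset.card_univ, Fintype.card_fin, nsmul_eq_mul]
    linear_combination (n : k) * (n : k) * hω
  refine ⟨main, fun hunit => ?_⟩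
  rw [main]
  exact hunit.neg.mul_right_eq_zero
end
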